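/- If $u_0 \in A_1$ and $0 < \varepsilon \le \frac{1}{2^{n+1}[u_0]_{A_1}}$, then $u_0^{1+\varepsilon} \in A_1$ with $[u_0^{1+\varepsilon}]_{A_1} \lesssim [u_0]_{A_1}$, with implicit constant depending only on the dimension $n$. -/

import Mathlib

open MeasureTheory ENNReal Set Filter

noncomputable section

/-- The measure with density `w` with respect to the ambient volume. -/
def wMeasure {α : Type*} [MeasureSpace α] (w : α → ℝ) : Measure α :=
  (volume : Measure α).withDensity fun x => ENNReal.ofReal (w x)

/-- The weak Lorentz `L^{q,∞}(μ)` quasi-norm. -/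
def wLorentz {α E : Type*} [MeasurableSpace α] [Norm E] (q : ℝ) (μ : Measure α)
    (g : α → E) : ℝ≥0∞ :=
  ⨆ (t : ℝ) (_ : 0 < t), ENNReal.ofReal t * μ {x | t < ‖g x‖} ^ (1 / q)

/-- The weak Lorentz `L^{q,∞}(μ)` quasi-norm, for `ℝ≥0∞`-valued functions. -/
def wLorentzE {α : Type*} [MeasurableSpace α] (q : ℝ) (μ : Measure α)
    (g : α → ℝ≥0∞) : ℝ≥0∞ :=
  ⨆ (t : ℝ) (_ : 0 < t), ENNReal.ofReal t * μ {x | ENNReal.ofReal t < g x} ^ (1 / q)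

/-- The Lorentz `L^{p,r}(μ)` quasi-norm (computed via the distribution function). -/
def lorentz {α E : Type*} [MeasurableSpace α] [Norm E] (p r : ℝ) (μ : Measure α)
    (g : α → E) : ℝ≥0∞ :=
  (∫⁻ t in Set.Ioi (0 : ℝ), ENNReal.ofReal (t ^ (r - 1)) * μ {x | t < ‖g x‖} ^ (r / p)) ^ (1 / r)

/-- A weight: a locally integrable, a.e. positive function. -/
def IsWeight {α : Type*} [MeasureSpace α] [TopologicalSpace α] (w : α → ℝ) : Prop :=
  LocallyIntegrable w volume ∧ ∀ᵐ x : α ∂volume, 0 < w x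

abbrev Rn (n : ℕ) : Type := Fin n → ℝ

/-- The axis-parallel closed cube with center `c` and half side-length `r`. -/
def cube {n : ℕ} (c : Rn n) (r : ℝ) : Set (Rn n) := {x | ∀ i, |x i - c i| ≤ r}

/-- The Hardy–Littlewood maximal operator over cubes. -/
def maxOp {n : ℕ} (f : Rn n → ℝ) (x : Rn n) : ℝ≥0∞ :=
  ⨆ (c : Rn n) (r : ℝ) (_ : 0 < r) (_ : x ∈ cube c r),
    (∫⁻ y in cube c r, ENNReal.ofReal |f y|) / volume (cube c r)

/-- The `A₁` constant: the least `C` with `Mu ≤ C u` a.e. -/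
def A1Const {n : ℕ} (u : Rn n → ℝ) : ℝ≥0∞ :=
  sInf {C : ℝ≥0∞ | ∀ᵐ x : Rn n ∂volume, maxOp u x ≤ C * ENNReal.ofReal (u x)}

def MemA1 {n : ℕ} (u : Rn n → ℝ) : Prop := IsWeight u ∧ A1Const u < ⊤

/-- The `RH∞` constant `sup_Q (ess sup_Q v) |Q| / v(Q)`. -/
def RHinfConst {n : ℕ} (v : Rn n → ℝ) : ℝ≥0∞ :=
  ⨆ (c : Rn n) (r : ℝ) (_ : 0 < r),
    essSup (fun x => ENNReal.ofReal (v x)) (volume.restrict (cube c r)) * volume (cube c r)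
      / wMeasure v (cube c r)

/-- The Fujii–Wilson `A∞` constant. -/
def FWConst {n : ℕ} (w : Rn n → ℝ) : ℝ≥0∞ :=
  ⨆ (c : Rn n) (r : ℝ) (_ : 0 < r),
    (∫⁻ x in cube c r, maxOp ((cube c r).indicator w) x) / wMeasure w (cube c r)

/-- The Muckenhoupt `A_q` constant, `q > 1`. -/
def AqConst {n : ℕ} (q : ℝ) (w : Rn n → ℝ) : ℝ≥0∞ :=
  ⨆ (c : Rn n) (r : ℝ) (_ : 0 < r),
    (wMeasure w (cube c r) / volume (cube c r)) *
      ((∫⁻ x in cube c r, ENNReal.ofReal (w x ^ (1 - q / (q - 1)))) / volume (cube c r)) ^ (q - 1)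

/-- Membership in `A∞ = ⋃_{q>1} A_q`. -/
def MemAinf {n : ℕ} (w : Rn n → ℝ) : Prop := ∃ q : ℝ, 1 < q ∧ AqConst q w < ⊤

/-- The restricted `A_q^𝓡` constant. -/
def AqRConst {n : ℕ} (q : ℝ) (w : Rn n → ℝ) : ℝ≥0∞ :=
  ⨆ (c : Rn n) (r : ℝ) (_ : 0 < r) (E : Set (Rn n)) (_ : MeasurableSet E)
    (_ : E ⊆ cube c r) (_ : 0 < volume E),
    volume E / volume (cube c r) * (wMeasure w (cube c r) / wMeasure w E) ^ (1 / q)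

/-- The constant `[w]_{RH∞¹} = inf {[u]_{A₁}[v]_{RH∞} : w = uv}`. -/
def RH1Const {n : ℕ} (w : Rn n → ℝ) : ℝ≥0∞ :=
  sInf {C : ℝ≥0∞ | ∃ u v : Rn n → ℝ, (∀ x, w x = u x * v x) ∧ MemA1 u ∧ IsWeight v ∧
    RHinfConst v < ⊤ ∧ C = A1Const u * RHinfConst v}

/-- `S f = (M(|Tf|^{1/2}))²`. -/
def Sop {n : ℕ} (T : (Rn n → ℝ) → Rn n → ℝ) (f : Rn n → ℝ) (x : Rn n) : ℝ≥0∞ :=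
  maxOp (fun y => |T f y| ^ ((2 : ℝ)⁻¹)) x ^ (2 : ℝ)

/-- Condition (C): for some `p₀` and increasing `φ`,
`∫ (Sf)^{p₀} w ≤ φ([w]_{A∞}) ∫ (Mf)^{p₀} w` for all `w ∈ A∞`. -/
def ConditionC {n : ℕ} (T : (Rn n → ℝ) → Rn n → ℝ) : Prop :=
  ∃ p0 : ℝ, 0 < p0 ∧ ∃ φ : ℝ≥0∞ → ℝ≥0∞, Monotone φ ∧
    ∀ w : Rn n → ℝ, IsWeight w → MemAinf w → ∀ f : Rn n → ℝ, Measurable f →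
      (∫⁻ x, Sop T f x ^ p0 * ENNReal.ofReal (w x)) < ⊤ →
      (∫⁻ x, Sop T f x ^ p0 * ENNReal.ofReal (w x)) ≤
        φ (FWConst w) * ∫⁻ x, maxOp f x ^ p0 * ENNReal.ofReal (w x)


section DyadicGrid

variable {n : ℕ}

/-- The label of the half-open cube containing `x` in the `k`-th dyadic subdivision of the grid
with origin `a` and mesh `s`. -/
def dyadicLabel (a : Rn n) (s : ℝ) (k : ℕ) (x : Rn n) : Fin n → ℤ :=
  fun i => ⌊2 ^ k * (x i - a i) / s⌋

/-- The half-open dyadic cube of generation `k` containing `x`. -/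
def dyadicCube (a : Rn n) (s : ℝ) (k : ℕ) (x : Rn n) : Set (Rn n) :=
  {y | dyadicLabel a s k y = dyadicLabel a s k x}

/-- The average of `f` over the dyadic cube of generation `k` containing `x`. -/
def dyadicAvg (a : Rn n) (s : ℝ) (f : Rn n → ℝ≥0∞) (k : ℕ) (x : Rn n) : ℝ≥0∞ :=
  (∫⁻ y in dyadicCube a s k x, f y) / volume (dyadicCube a s k x)

/-- The dyadic maximal function truncated at generation `k`. -/
def dyadicMax (a : Rn n) (s : ℝ) (f : Rn n → ℝ≥0∞) : ℕ → Rn n → ℝ≥0∞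
  | 0, x => dyadicAvg a s f 0 x
  | k + 1, x => max (dyadicMax a s f k x) (dyadicAvg a s f (k + 1) x)

theorem cube_eq_Icc (c : Rn n) (r : ℝ) :
    cube c r = Icc (fun i => c i - r) (fun i => c i + r) := by
  ext x
  simp only [cube, mem_ofPred_eq, mem_Icc, Pi.le_def, abs_le, ← forall_and]
  exact forall_congr' fun i => by constructor <;> intro h <;> constructor <;> linarith [h.1, h.2]

theorem cube_eq_closedBall (c : Rn n) {r : ℝ} (hr : 0 ≤ r) : cube c r = Metric.closedBall c r := by
  ext x
  simp [cube, dist_pi_le_iff hr, Real.dist_eq]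

/-- The center of the dyadic cube of generation `k` containing `x`. -/
def dyadicCenter (a : Rn n) (s : ℝ) (k : ℕ) (x : Rn n) : Rn n :=
  fun i => a i + (dyadicLabel a s k x i + 1 / 2) * (s / 2 ^ k)

theorem dyadicCube_eq_pi (a : Rn n) {s : ℝ} (hs : 0 < s) (k : ℕ) (x : Rn n) :
    dyadicCube a s k x = Set.pi univ fun i =>
      Ico (dyadicCenter a s k x i - s / 2 ^ k / 2) (dyadicCenter a s k x i + s / 2 ^ k / 2) := by
  ext y
  simp only [dyadicCube, mem_ofPred_eq, funext_iff, Set.mem_pi, mem_univ, forall_true_left, mem_Ico]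
  refine forall_congr' fun i => ?_
  have hd : 0 < s / 2 ^ k := by positivity
  have e : 2 ^ k * (y i - a i) / s = (y i - a i) / (s / 2 ^ k) := by field_simp
  rw [show dyadicLabel a s k y i = ⌊2 ^ k * (y i - a i) / s⌋ from rfl, e, Int.floor_eq_iff,
    le_div_iff₀ hd, div_lt_iff₀ hd]
  simp only [dyadicCenter]
  constructor <;> rintro ⟨h1, h2⟩ <;> constructor <;> linarith

theorem dyadicCube_ae_eq (a : Rn n) {s : ℝ} (hs : 0 < s) (k : ℕ) (x : Rn n) :
    dyadicCube a s k x =ᵐ[volume] cube (dyadicCenter a s k x) (s / 2 ^ k / 2) := by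
  rw [dyadicCube_eq_pi a hs, cube_eq_Icc]
  exact Measure.univ_pi_Ico_ae_eq_Icc

theorem volume_dyadicCube (a : Rn n) {s : ℝ} (hs : 0 < s) (k : ℕ) (x : Rn n) :
    volume (dyadicCube a s k x) = ENNReal.ofReal (s / 2 ^ k) ^ n := by
  rw [dyadicCube_eq_pi a hs, Real.volume_pi_Ico]
  simp [← two_mul, mul_div_cancel₀]

theorem volume_dyadicCube_ne_zero (a : Rn n) {s : ℝ} (hs : 0 < s) (k : ℕ) (x : Rn n) :
    volume (dyadicCube a s k x) ≠ 0 := by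
  rw [volume_dyadicCube a hs]
  have : 0 < s / 2 ^ k := by positivity
  exact pow_ne_zero _ (by simpa using this)

theorem volume_dyadicCube_ne_top (a : Rn n) {s : ℝ} (hs : 0 < s) (k : ℕ) (x : Rn n) :
    volume (dyadicCube a s k x) ≠ ⊤ := by
  rw [volume_dyadicCube a hs]
  exact ENNReal.pow_ne_top ENNReal.ofReal_ne_top

theorem self_mem_dyadicCube (a : Rn n) (s : ℝ) (k : ℕ) (x : Rn n) : x ∈ dyadicCube a s k x := rfl

theorem mem_cube_dyadicCenter (a : Rn n) {s : ℝ} (hs : 0 < s) (k : ℕ) (x : Rn n) :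
    x ∈ cube (dyadicCenter a s k x) (s / 2 ^ k / 2) := by
  have h := self_mem_dyadicCube a s k x
  rw [dyadicCube_eq_pi a hs] at h
  rw [cube_eq_Icc]
  exact ⟨fun i => (h i (mem_univ i)).1, fun i => (h i (mem_univ i)).2.le⟩

theorem dyadicLabel_eq_of_succ {a : Rn n} {s : ℝ} {k : ℕ} {x y : Rn n}
    (h : dyadicLabel a s (k + 1) x = dyadicLabel a s (k + 1) y) :
    dyadicLabel a s k x = dyadicLabel a s k y := by
  have key (z : Rn n) (i : Fin n) : dyadicLabel a s k z i = dyadicLabel a s (k + 1) z i / 2 := by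
    have e : 2 ^ k * (z i - a i) / s = 2 ^ (k + 1) * (z i - a i) / s / (2 : ℕ) := by
      push_cast; ring
    simp only [dyadicLabel]
    rw [e, Int.floor_div_natCast]
    rfl
  funext i
  rw [key, key, h]

theorem dyadicLabel_zero_eq {a : Rn n} {s : ℝ} {k : ℕ} {x y : Rn n}
    (h : dyadicLabel a s k x = dyadicLabel a s k y) :
    dyadicLabel a s 0 x = dyadicLabel a s 0 y := by
  induction k with
  | zero => exact h
  | succ k ih => exact ih (dyadicLabel_eq_of_succ h)

theorem measurable_dyadicLabel (a : Rn n) (s : ℝ) (k : ℕ) : Measurable (dyadicLabel a s k) := by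
  refine measurable_pi_lambda _ fun i => Int.measurable_floor.comp ?_
  fun_prop

theorem measurable_of_dyadicLabel {a : Rn n} {s : ℝ} {k : ℕ} {g : Rn n → ℝ≥0∞}
    (hg : ∀ x y, dyadicLabel a s k x = dyadicLabel a s k y → g x = g y) : Measurable g := by
  obtain ⟨g', rfl⟩ : ∃ g', g = g' ∘ dyadicLabel a s k :=
    (Function.factorsThrough_iff g).1 fun x y => hg x y
  exact (measurable_of_countable g').comp (measurable_dyadicLabel a s k)

theorem measurableSet_dyadicCube (a : Rn n) (s : ℝ) (k : ℕ) (x : Rn n) :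
    MeasurableSet (dyadicCube a s k x) :=
  measurable_dyadicLabel a s k (measurableSet_singleton (dyadicLabel a s k x))

theorem dyadicAvg_congr (f : Rn n → ℝ≥0∞) {a : Rn n} {s : ℝ} {k : ℕ} {x y : Rn n}
    (h : dyadicLabel a s k x = dyadicLabel a s k y) :
    dyadicAvg a s f k x = dyadicAvg a s f k y := by
  simp only [dyadicAvg, dyadicCube, h]

theorem dyadicMax_congr (f : Rn n → ℝ≥0∞) {a : Rn n} {s : ℝ} {k : ℕ} {x y : Rn n}
    (h : dyadicLabel a s k x = dyadicLabel a s k y) :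
    dyadicMax a s f k x = dyadicMax a s f k y := by
  induction k with
  | zero => exact dyadicAvg_congr f h
  | succ k ih => simp only [dyadicMax, ih (dyadicLabel_eq_of_succ h), dyadicAvg_congr f h]

/-- A function constant on the dyadic cubes of generation `k` does not see the difference between
`f` and its averages over these cubes. -/
theorem lintegral_mul_dyadicAvg (a : Rn n) {s : ℝ} (hs : 0 < s) (k : ℕ) {f : Rn n → ℝ≥0∞}
    (hfm : AEMeasurable f volume) {g : Rn n → ℝ≥0∞} (hg : ∀ x y, dyadicLabel a s k x = dyadicLabel a s k y → g x = g y) :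
    ∫⁻ x, g x * f x = ∫⁻ x, g x * dyadicAvg a s f k x := by
  have hm (z : Fin n → ℤ) : MeasurableSet (dyadicLabel a s k ⁻¹' {z}) :=
    measurable_dyadicLabel a s k (measurableSet_singleton z)
  have hd : Pairwise (Function.onFun Disjoint fun z => dyadicLabel a s k ⁻¹' {z}) :=
    fun z w hzw => Disjoint.preimage _ (by simpa using hzw)
  have split (h : Rn n → ℝ≥0∞) :
      ∫⁻ x, h x = ∑' z, ∫⁻ x in dyadicLabel a s k ⁻¹' {z}, h x := by
    rw [← lintegral_iUnion hm hd, ← preimage_iUnion, iUnion_of_singleton, preimage_univ,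
      setLIntegral_univ]
  rw [split, split]
  refine tsum_congr fun z => ?_
  rcases (dyadicLabel a s k ⁻¹' {z}).eq_empty_or_nonempty with h0 | ⟨x₀, rfl⟩
  · simp [h0]
  change ∫⁻ x in dyadicCube a s k x₀, g x * f x =
    ∫⁻ x in dyadicCube a s k x₀, g x * dyadicAvg a s f k x
  have hQ := measurableSet_dyadicCube a s k x₀
  have hl : ∫⁻ x in dyadicCube a s k x₀, g x * f x = ∫⁻ x in dyadicCube a s k x₀, g x₀ * f x :=
    setLIntegral_congr_fun hQ fun x hx => by simp only [hg x x₀ hx]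
  have hr : ∫⁻ x in dyadicCube a s k x₀, g x * dyadicAvg a s f k x =
      ∫⁻ _ in dyadicCube a s k x₀, g x₀ * dyadicAvg a s f k x₀ :=
    setLIntegral_congr_fun hQ fun x hx => by simp only [hg x x₀ hx, dyadicAvg_congr f hx]
  have hg0 : ∫⁻ x in dyadicCube a s k x₀, g x₀ * f x =
      g x₀ * ∫⁻ x in dyadicCube a s k x₀, f x := lintegral_const_mul'' _ hfm.restrict
  rw [hl, hr, hg0, setLIntegral_const, mul_assoc, dyadicAvg,
    ENNReal.div_mul_cancel (volume_dyadicCube_ne_zero a hs k x₀)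
      (volume_dyadicCube_ne_top a hs k x₀)]

theorem dyadicAvg_le (a : Rn n) {s : ℝ} (hs : 0 < s) (f : Rn n → ℝ≥0∞) (k : ℕ) (x : Rn n) :
    dyadicAvg a s f k x ≤ (∫⁻ y, f y) / ENNReal.ofReal (s / 2 ^ k) ^ n := by
  rw [dyadicAvg, volume_dyadicCube a hs]
  gcongr
  exact Measure.restrict_le_self

theorem dyadicAvg_ne_top (a : Rn n) {s : ℝ} (hs : 0 < s) {f : Rn n → ℝ≥0∞}
    (hf : ∫⁻ y, f y ≠ ⊤) (k : ℕ) (x : Rn n) : dyadicAvg a s f k x ≠ ⊤ :=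
  ENNReal.div_ne_top (ne_top_of_le_ne_top hf (lintegral_mono' Measure.restrict_le_self le_rfl))
    (volume_dyadicCube_ne_zero a hs k x)

theorem exists_dyadicMax_le (a : Rn n) {s : ℝ} (hs : 0 < s) {f : Rn n → ℝ≥0∞}
    (hf : ∫⁻ y, f y ≠ ⊤) (k : ℕ) : ∃ B : ℝ≥0∞, B ≠ ⊤ ∧ ∀ x, dyadicMax a s f k x ≤ B := by
  have hB (k : ℕ) : (∫⁻ y, f y) / ENNReal.ofReal (s / 2 ^ k) ^ n ≠ ⊤ := by
    refine ENNReal.div_ne_top hf (pow_ne_zero _ ?_)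
    have : 0 < s / 2 ^ k := by positivity
    simpa using this
  induction k with
  | zero => exact ⟨_, hB 0, dyadicAvg_le a hs f 0⟩
  | succ k ih =>
    obtain ⟨B, hB', h⟩ := ih
    exact ⟨max B _, by simpa using ⟨hB', hB (k + 1)⟩,
      fun x => max_le_max (h x) (dyadicAvg_le a hs f (k + 1) x)⟩

theorem dyadicAvg_le_dyadicMax (a : Rn n) (s : ℝ) (f : Rn n → ℝ≥0∞) (k : ℕ) (x : Rn n) :
    dyadicAvg a s f k x ≤ dyadicMax a s f k x := by
  cases k with
  | zero => exact le_rfl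
  | succ k => exact le_max_right _ _

theorem dyadicAvg_succ_le (a : Rn n) {s : ℝ} (hs : 0 < s) (f : Rn n → ℝ≥0∞) (k : ℕ) (x : Rn n) :
    dyadicAvg a s f (k + 1) x ≤ 2 ^ n * dyadicAvg a s f k x := by
  have hsub : dyadicCube a s (k + 1) x ⊆ dyadicCube a s k x := fun y hy => dyadicLabel_eq_of_succ hy
  have hv : volume (dyadicCube a s k x) = 2 ^ n * volume (dyadicCube a s (k + 1) x) := by
    rw [volume_dyadicCube a hs, volume_dyadicCube a hs, ← mul_pow]
    congr 1
    rw [← ENNReal.ofReal_ofNat 2, ← ENNReal.ofReal_mul (by norm_num)]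
    congr 1
    rw [pow_succ]
    field_simp
  have h2 : (2 : ℝ≥0∞) ^ n ≠ 0 := by simp
  have h2' : (2 : ℝ≥0∞) ^ n ≠ ⊤ := by simp
  rw [dyadicAvg, dyadicAvg, hv, ← mul_div_assoc, ENNReal.mul_div_mul_left _ _ h2 h2']
  gcongr

theorem dyadicMax_le {a : Rn n} {s : ℝ} {f : Rn n → ℝ≥0∞} {x : Rn n} {B : ℝ≥0∞}
    (h : ∀ k, dyadicAvg a s f k x ≤ B) (k : ℕ) : dyadicMax a s f k x ≤ B := by
  induction k with
  | zero => exact h 0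
  | succ k ih => exact max_le ih (h (k + 1))

theorem ae_tendsto_dyadicAvg (a : Rn n) {s : ℝ} (hs : 0 < s) {f : Rn n → ℝ≥0∞}
    (hfm : AEMeasurable f volume) (hf : ∫⁻ y, f y ≠ ⊤) :
    ∀ᵐ x, Tendsto (fun k => dyadicAvg a s f k x) atTop (nhds (f x)) := by
  filter_upwards [(IsUnifLocDoublingMeasure.vitaliFamily (volume : Measure (Rn n))
    1).ae_tendsto_lintegral_div hfm hf] with x hx
  have hpos (k : ℕ) : 0 < s / 2 ^ k / 2 := by positivity
  have hr : Tendsto (fun k : ℕ => s / 2 ^ k / 2) atTop (nhdsWithin 0 (Ioi 0)) := by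
    refine tendsto_nhdsWithin_iff.2 ⟨?_, Eventually.of_forall hpos⟩
    have := (tendsto_pow_atTop_nhds_zero_of_lt_one (r := (1 / 2 : ℝ)) (by norm_num)
      (by norm_num)).const_mul (s / 2)
    rw [mul_zero] at this
    refine this.congr fun k => ?_
    rw [one_div, inv_pow]
    ring
  have hb := IsUnifLocDoublingMeasure.tendsto_closedBall_filterAt (μ := (volume : Measure (Rn n)))
    (K := 1) (x := x) (fun k => dyadicCenter a s k x) _ hr (Eventually.of_forall fun k => by
      rw [one_mul, ← cube_eq_closedBall _ (hpos k).le]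
      exact mem_cube_dyadicCenter a hs k x)
  refine (hx.comp hb).congr fun k => ?_
  have hae := dyadicCube_ae_eq a hs k x
  simp only [Function.comp_apply, ← cube_eq_closedBall _ (hpos k).le, dyadicAvg]
  rw [setLIntegral_congr hae, measure_congr hae]

end DyadicGrid

theorem max_rpow_mul_add_le {n : ℕ} {ε : ℝ} (hε : 0 < ε) {m v : ℝ≥0∞} (hm : m ≠ ⊤) (hv : v ≠ ⊤)
    (h : v ≤ 2 ^ n * m) :
    max m v ^ ε * v + ENNReal.ofReal (2 ^ n * ε) * m ^ (1 + ε) ≤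
      m ^ ε * v + ENNReal.ofReal (2 ^ n * ε) * max m v ^ (1 + ε) := by
  rcases le_or_gt v m with hvm | hmv
  · rw [max_eq_left hvm]
  rw [max_eq_right hmv.le]
  lift m to NNReal using hm
  lift v to NNReal using hv
  have hm0 : (0 : ℝ) < m := by
    rcases eq_or_ne m 0 with rfl | h0
    · simp at h hmv
      exact absurd h hmv.ne'
    · exact_mod_cast pos_iff_ne_zero.2 h0
  have hmv' : (m : ℝ) < v := by exact_mod_cast hmv
  have h' : (v : ℝ) ≤ 2 ^ n * m := by exact_mod_cast h
  have hv0 : (0 : ℝ) < v := hm0.trans hmv'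
  have hreal : (v : ℝ) ^ ε * v + 2 ^ n * ε * (m : ℝ) ^ (1 + ε) ≤
      (m : ℝ) ^ ε * v + 2 ^ n * ε * (v : ℝ) ^ (1 + ε) := by
    have hlog : 1 - (v : ℝ) / m ≤ Real.log (m / v) := by
      have := Real.one_sub_inv_le_log_of_pos (div_pos hm0 hv0)
      rwa [inv_div] at this
    have hexp : (m : ℝ) ^ ε ≥ (v : ℝ) ^ ε * (1 + ε * (1 - v / m)) := by
      have e1 : (m : ℝ) ^ ε = (v : ℝ) ^ ε * Real.exp (Real.log (m / v) * ε) := by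
        rw [← Real.rpow_def_of_pos (div_pos hm0 hv0), ← Real.mul_rpow hv0.le (by positivity),
          mul_div_cancel₀ _ hv0.ne']
      rw [e1]
      gcongr
      nlinarith [Real.add_one_le_exp (Real.log (m / v) * ε)]
    have hdiff : (v : ℝ) ^ ε - (m : ℝ) ^ ε ≤ (v : ℝ) ^ ε * ε * ((v - m) / m) := by
      have : (v - m : ℝ) / m = v / m - 1 := by field_simp
      rw [this]
      linarith
    have hmul : ((v : ℝ) ^ ε - (m : ℝ) ^ ε) * v ≤ 2 ^ n * ε * ((v : ℝ) ^ ε * (v - m)) := by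
      calc ((v : ℝ) ^ ε - (m : ℝ) ^ ε) * v ≤ ((v : ℝ) ^ ε * ε * ((v - m) / m)) * (2 ^ n * m) := by
            have : 0 ≤ (v - m : ℝ) := by linarith
            gcongr
        _ = 2 ^ n * ε * ((v : ℝ) ^ ε * (v - m)) := by field_simp
    have hmono : (m : ℝ) ^ ε ≤ (v : ℝ) ^ ε := Real.rpow_le_rpow hm0.le hmv'.le hε.le
    have hlast : (v : ℝ) ^ ε * (v - m) ≤ (v : ℝ) ^ (1 + ε) - (m : ℝ) ^ (1 + ε) := by
      rw [Real.rpow_add hm0, Real.rpow_add hv0, Real.rpow_one, Real.rpow_one]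
      nlinarith
    have := mul_le_mul_of_nonneg_left hlast (show (0 : ℝ) ≤ 2 ^ n * ε by positivity)
    linarith
  have h1ε : 0 ≤ 1 + ε := by linarith
  have := ENNReal.ofReal_le_ofReal hreal
  rw [ENNReal.ofReal_add (by positivity) (by positivity),
    ENNReal.ofReal_add (by positivity) (by positivity)] at this
  simpa only [ENNReal.ofReal_mul (Real.rpow_nonneg v.coe_nonneg ε),
    ENNReal.ofReal_mul (Real.rpow_nonneg m.coe_nonneg ε),
    ENNReal.ofReal_mul (show (0 : ℝ) ≤ 2 ^ n * ε by positivity),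
    ← ENNReal.ofReal_rpow_of_nonneg m.coe_nonneg hε.le,
    ← ENNReal.ofReal_rpow_of_nonneg v.coe_nonneg hε.le,
    ← ENNReal.ofReal_rpow_of_nonneg m.coe_nonneg h1ε,
    ← ENNReal.ofReal_rpow_of_nonneg v.coe_nonneg h1ε, ENNReal.ofReal_coe_nnreal] using this

theorem lintegral_dyadicMax_rpow_mul_add_le {n : ℕ} (a : Rn n) {s : ℝ} (hs : 0 < s)
    {f : Rn n → ℝ≥0∞} (hfm : AEMeasurable f volume) (hf : ∫⁻ y, f y ≠ ⊤) {ε : ℝ} (hε : 0 < ε)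
    (k : ℕ) :
    (∫⁻ x, dyadicMax a s f (k + 1) x ^ ε * f x) +
        ENNReal.ofReal (2 ^ n * ε) * ∫⁻ x, dyadicMax a s f k x ^ (1 + ε) ≤
      (∫⁻ x, dyadicMax a s f k x ^ ε * f x) +
        ENNReal.ofReal (2 ^ n * ε) * ∫⁻ x, dyadicMax a s f (k + 1) x ^ (1 + ε) := by
  have hM (k : ℕ) : Measurable (dyadicMax a s f k) :=
    measurable_of_dyadicLabel fun _ _ => dyadicMax_congr f
  have hfin (x : Rn n) : dyadicMax a s f k x ≠ ⊤ := by
    obtain ⟨B, hB, h⟩ := exists_dyadicMax_le a hs hf k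
    exact ne_top_of_le_ne_top hB (h x)
  rw [lintegral_mul_dyadicAvg a hs (k + 1) hfm
      fun x y hxy => by rw [dyadicMax_congr f hxy],
    lintegral_mul_dyadicAvg a hs (k + 1) hfm (g := fun x => dyadicMax a s f k x ^ ε)
      fun x y hxy => by rw [dyadicMax_congr f (dyadicLabel_eq_of_succ hxy)],
    ← lintegral_const_mul _ ((hM k).pow_const _),
    ← lintegral_const_mul _ ((hM (k + 1)).pow_const _),
    ← lintegral_add_right _ (((hM k).pow_const _).const_mul _),
    ← lintegral_add_right _ (((hM (k + 1)).pow_const _).const_mul _)]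
  refine lintegral_mono fun x => ?_
  refine max_rpow_mul_add_le hε (hfin x) (dyadicAvg_ne_top a hs hf (k + 1) x) ?_
  refine (dyadicAvg_succ_le a hs f k x).trans ?_
  gcongr
  exact dyadicAvg_le_dyadicMax a s f k x

/-- The reverse Hölder inequality for a function whose dyadic maximal function is controlled by
the function itself. -/
theorem lintegral_rpow_one_add_le {n : ℕ} (a : Rn n) {s : ℝ} (hs : 0 < s)
    {f : Rn n → ℝ≥0∞} (hfm : AEMeasurable f volume) (hf : ∫⁻ y, f y ≠ ⊤) (hf' : ∀ x, f x ≠ ⊤)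
    {ε : ℝ} (hε : 0 < ε) {A : ℝ≥0∞} (hA : A ≠ ⊤)
    (hεA : ENNReal.ofReal ε * (2 ^ (n + 1) * A) ≤ 1)
    (hfA : ∀ᵐ x, ∀ k, dyadicAvg a s f k x ≤ A * f x)
    {B : ℝ≥0∞} (hB : ∀ x, dyadicAvg a s f 0 x ≤ B) :
    ∫⁻ x, f x ^ (1 + ε) ≤ 2 * (B ^ ε * ∫⁻ x, f x) := by
  set c := ENNReal.ofReal (2 ^ n * ε) with hc
  have hM (k : ℕ) : Measurable (dyadicMax a s f k) :=
    measurable_of_dyadicLabel fun _ _ => dyadicMax_congr f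
  have hfin (k : ℕ) : ∫⁻ x, dyadicMax a s f k x ^ ε * f x ≠ ⊤ := by
    obtain ⟨D, hD, h⟩ := exists_dyadicMax_le a hs hf k
    refine ne_top_of_le_ne_top
      (ENNReal.mul_ne_top (ENNReal.rpow_ne_top_of_nonneg hε.le hD) hf) ?_
    rw [← lintegral_const_mul'' _ hfm]
    gcongr with x
    exact h x
  have hpow (k : ℕ) : ∫⁻ x, dyadicMax a s f k x ^ (1 + ε) ≤
      A * ∫⁻ x, dyadicMax a s f k x ^ ε * f x := by
    rw [← lintegral_const_mul' _ _ hA]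
    refine lintegral_mono_ae ?_
    filter_upwards [hfA] with x hx
    rw [ENNReal.rpow_add_of_nonneg _ _ zero_le_one hε.le, ENNReal.rpow_one]
    calc dyadicMax a s f k x * dyadicMax a s f k x ^ ε
        ≤ A * f x * dyadicMax a s f k x ^ ε := by
          gcongr
          exact dyadicMax_le hx k
      _ = A * (dyadicMax a s f k x ^ ε * f x) := by ring
  have hpow_fin (k : ℕ) : c * ∫⁻ x, dyadicMax a s f k x ^ (1 + ε) ≠ ⊤ :=
    ENNReal.mul_ne_top ENNReal.ofReal_ne_top
      (ne_top_of_le_ne_top (ENNReal.mul_ne_top hA (hfin k)) (hpow k))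
  have hind (k : ℕ) : ∫⁻ x, dyadicMax a s f k x ^ ε * f x ≤
      B ^ ε * (∫⁻ x, f x) + c * ∫⁻ x, dyadicMax a s f k x ^ (1 + ε) := by
    induction k with
    | zero =>
      refine le_add_right ?_
      rw [← lintegral_const_mul'' _ hfm]
      gcongr with x
      exact hB x
    | succ k ih =>
      refine (ENNReal.add_le_add_iff_right (hpow_fin k)).1 ?_
      refine (lintegral_dyadicMax_rpow_mul_add_le a hs hfm hf hε k).trans ?_
      rw [add_right_comm]
      gcongr
  have hcA : 2 * (c * A) ≤ 1 := by
    refine le_trans (le_of_eq ?_) hεA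
    rw [hc, ENNReal.ofReal_mul (by positivity), ENNReal.ofReal_pow (by norm_num),
      ENNReal.ofReal_ofNat]
    ring
  have hbound (k : ℕ) : ∫⁻ x, dyadicMax a s f k x ^ ε * f x ≤ 2 * (B ^ ε * ∫⁻ x, f x) := by
    set I := ∫⁻ x, dyadicMax a s f k x ^ ε * f x
    refine (ENNReal.add_le_add_iff_right (hfin k)).1 ?_
    calc I + I = 2 * I := (two_mul I).symm
      _ ≤ 2 * (B ^ ε * (∫⁻ x, f x) + c * (A * I)) := by
          gcongr
          exact (hind k).trans (by gcongr; exact hpow k)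
      _ = 2 * (B ^ ε * ∫⁻ x, f x) + 2 * (c * A) * I := by ring
      _ ≤ 2 * (B ^ ε * ∫⁻ x, f x) + I := by
          gcongr
          exact mul_le_of_le_one_left' hcA
  have hlim : ∀ᵐ x, f x ^ (1 + ε) = liminf (fun k => dyadicAvg a s f k x ^ ε * f x) atTop := by
    filter_upwards [ae_tendsto_dyadicAvg a hs hfm hf] with x hx
    refine (Tendsto.liminf_eq ?_).symm
    rw [add_comm, ENNReal.rpow_add_of_nonneg _ _ hε.le zero_le_one, ENNReal.rpow_one]
    exact ENNReal.Tendsto.mul_const ((ENNReal.continuous_rpow_const.tendsto _).comp hx)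
      (Or.inr (hf' x))
  have hVm (k : ℕ) : Measurable (dyadicAvg a s f k) :=
    measurable_of_dyadicLabel fun _ _ => dyadicAvg_congr f
  calc ∫⁻ x, f x ^ (1 + ε)
      = ∫⁻ x, liminf (fun k => dyadicAvg a s f k x ^ ε * f x) atTop := lintegral_congr_ae hlim
    _ ≤ liminf (fun k => ∫⁻ x, dyadicAvg a s f k x ^ ε * f x) atTop :=
        lintegral_liminf_le' fun k => ((hVm k).pow_const ε).aemeasurable.mul hfm
    _ ≤ 2 * (B ^ ε * ∫⁻ x, f x) := by
        refine liminf_le_of_le (by isBoundedDefault) fun b hb => ?_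
        obtain ⟨k, hk⟩ := hb.exists
        refine hk.trans (le_trans ?_ (hbound k))
        gcongr with x
        exact dyadicAvg_le_dyadicMax a s f k x

theorem le_maxOp {n : ℕ} (u : Rn n → ℝ) {c x : Rn n} {r : ℝ} (hr : 0 < r) (hx : x ∈ cube c r) :
    (∫⁻ y in cube c r, ENNReal.ofReal |u y|) / volume (cube c r) ≤ maxOp u x :=
  le_iSup₂_of_le c r (le_iSup₂_of_le hr hx le_rfl)

theorem dyadicAvg_le_maxOp {n : ℕ} (u : Rn n → ℝ) (a : Rn n) {s : ℝ} (hs : 0 < s) (k : ℕ)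
    (x : Rn n) : dyadicAvg a s (fun y => ENNReal.ofReal |u y|) k x ≤ maxOp u x := by
  have hae := dyadicCube_ae_eq a hs k x
  rw [dyadicAvg, setLIntegral_congr hae, measure_congr hae]
  exact le_maxOp u (by positivity) (mem_cube_dyadicCenter a hs k x)

/-- The infimum defining the `A₁` constant is attained. -/
theorem ae_maxOp_le_A1Const_mul {n : ℕ} {u : Rn n → ℝ} (hu : A1Const u < ⊤) :
    ∀ᵐ x, maxOp u x ≤ A1Const u * ENNReal.ofReal (u x) := by
  have hne : {C : ℝ≥0∞ | ∀ᵐ x : Rn n ∂volume,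
      maxOp u x ≤ C * ENNReal.ofReal (u x)}.Nonempty := by
    rw [nonempty_iff_ne_empty]
    intro h
    rw [A1Const, h, sInf_empty] at hu
    exact hu.ne rfl
  set S := {C : ℝ≥0∞ | ∀ᵐ x : Rn n ∂volume, maxOp u x ≤ C * ENNReal.ofReal (u x)}
  obtain ⟨C, -, hC, hCS⟩ := exists_seq_tendsto_sInf (S := S) hne (OrderBot.bddBelow _)
  filter_upwards [ae_all_iff.2 hCS] with x hx
  exact ge_of_tendsto' (ENNReal.Tendsto.mul_const hC (Or.inr ENNReal.ofReal_ne_top)) hx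

theorem rpow_le_three {n : ℕ} {ε : ℝ} (hε : 0 < ε) {A : ℝ≥0∞} (hA : A ≠ ⊤)
    (hεA : ENNReal.ofReal ε * (2 ^ (n + 1) * A) ≤ 1) : A ^ ε ≤ 3 := by
  lift A to NNReal using hA
  have h : ε * A ≤ 1 := by
    have h1 : ENNReal.ofReal ε * A ≤ 1 := by
      refine le_trans ?_ hεA
      gcongr
      exact le_mul_of_one_le_left' (one_le_pow₀ one_le_two)
    rw [← ENNReal.ofReal_coe_nnreal, ← ENNReal.ofReal_mul hε.le, ← ENNReal.ofReal_one] at h1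
    exact (ENNReal.ofReal_le_ofReal_iff zero_le_one).1 h1
  rw [← ENNReal.ofReal_coe_nnreal, ENNReal.ofReal_rpow_of_nonneg A.coe_nonneg hε.le,
    ← ENNReal.ofReal_ofNat 3]
  refine ENNReal.ofReal_le_ofReal ?_
  calc (A : ℝ) ^ ε ≤ Real.exp A ^ ε := by
        gcongr
        linarith [Real.add_one_le_exp (A : ℝ)]
    _ = Real.exp (ε * A) := by rw [← Real.exp_mul, mul_comm]
    _ ≤ Real.exp 1 := Real.exp_le_exp.2 h
    _ ≤ 3 := by linarith [Real.exp_one_lt_d9]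

/-- The reverse Hölder inequality for `A₁` weights. -/
theorem setLIntegral_cube_rpow_le {n : ℕ} {u : Rn n → ℝ} (hu : MemA1 u) {ε : ℝ} (hε : 0 < ε)
    (hεA : ENNReal.ofReal ε * (2 ^ (n + 1) * A1Const u) ≤ 1) (c : Rn n) {r : ℝ} (hr : 0 < r) :
    ∫⁻ x in cube c r, ENNReal.ofReal |u x| ^ (1 + ε) ≤
      2 * (((∫⁻ x in cube c r, ENNReal.ofReal |u x|) / volume (cube c r)) ^ ε *
        ∫⁻ x in cube c r, ENNReal.ofReal |u x|) := by
  obtain ⟨⟨hloc, -⟩, hA⟩ := hu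
  set a : Rn n := fun i => c i - r with ha
  obtain ⟨s, hs_def⟩ : ∃ s : ℝ, s = 2 * r := ⟨_, rfl⟩
  have hs : 0 < s := by rw [hs_def]; positivity
  set Q := dyadicCube a s 0 c
  have hQm : MeasurableSet Q := measurableSet_dyadicCube a s 0 c
  have hcenter : dyadicCenter a s 0 c = c := by
    funext i
    have : (c i - a i) / s = 1 / 2 := by
      rw [hs_def, div_eq_iff (by positivity)]
      simp only [ha]
      ring
    have h0 : dyadicLabel a s 0 c i = 0 := by
      simp only [dyadicLabel, pow_zero, one_mul, this]
      norm_num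
    rw [dyadicCenter, h0, Int.cast_zero, pow_zero, div_one, hs_def]
    simp only [ha]
    ring
  have hae : Q =ᵐ[volume] cube c r := by
    have := dyadicCube_ae_eq a hs 0 c
    rwa [hcenter, pow_zero, div_one, show s / 2 = r by rw [hs_def]; ring] at this
  set w : Rn n → ℝ≥0∞ := fun x => ENNReal.ofReal |u x| with hw
  have hwm : AEMeasurable w volume :=
    hloc.aestronglyMeasurable.aemeasurable.abs.ennreal_ofReal
  set f : Rn n → ℝ≥0∞ := Q.indicator w with hf_def
  have hf : ∫⁻ x, f x = ∫⁻ x in cube c r, w x := by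
    rw [hf_def, lintegral_indicator hQm, setLIntegral_congr hae]
  have hf_top : ∫⁻ x, f x ≠ ⊤ := by
    rw [hf, cube_eq_closedBall c hr.le]
    have := (hloc.integrableOn_isCompact (isCompact_closedBall c r)).hasFiniteIntegral
    exact (hasFiniteIntegral_iff_norm _ |>.1 this).ne
  have hfw (x : Rn n) : f x ≤ w x := indicator_le_self _ _ x
  have hfA : ∀ᵐ x, ∀ k, dyadicAvg a s f k x ≤ A1Const u * f x := by
    filter_upwards [ae_maxOp_le_A1Const_mul hA] with x hx k
    by_cases hxQ : x ∈ Q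
    · calc dyadicAvg a s f k x ≤ dyadicAvg a s w k x := by
            unfold dyadicAvg
            gcongr with y
            exact hfw y
        _ ≤ maxOp u x := dyadicAvg_le_maxOp u a hs k x
        _ ≤ A1Const u * ENNReal.ofReal (u x) := hx
        _ ≤ A1Const u * f x := by
            rw [hf_def, indicator_of_mem hxQ]
            gcongr
            exact ENNReal.ofReal_le_ofReal (le_abs_self _)
    · have h0 : ∫⁻ y in dyadicCube a s k x, f y = 0 := by
        rw [setLIntegral_congr_fun (measurableSet_dyadicCube a s k x) (g := fun _ => 0)]
        · simp
        · intro y hy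
          refine indicator_of_notMem (fun hyQ => hxQ ?_) _
          exact (dyadicLabel_zero_eq hy).symm.trans hyQ
      rw [dyadicAvg, h0, ENNReal.zero_div]
      exact zero_le
  have hB (x : Rn n) : dyadicAvg a s f 0 x ≤ (∫⁻ x in cube c r, w x) / volume (cube c r) := by
    refine (dyadicAvg_le a hs f 0 x).trans (le_of_eq ?_)
    rw [hf, ← measure_congr hae, volume_dyadicCube a hs]
  have key := lintegral_rpow_one_add_le a hs (hwm.indicator hQm) hf_top
    (fun x => ne_top_of_le_ne_top ENNReal.ofReal_ne_top (hfw x)) hε hA.ne hεA hfA hB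
  rw [hf] at key
  refine le_trans (le_of_eq ?_) key
  rw [← setLIntegral_congr hae, ← lintegral_indicator hQm]
  refine lintegral_congr fun x => ?_
  by_cases hxQ : x ∈ Q
  · simp [hxQ, hw]
  · simp [hxQ, show 0 < 1 + ε by linarith]

theorem maxOp_rpow_le {n : ℕ} {u : Rn n → ℝ} (hu : MemA1 u) {ε : ℝ} (hε : 0 < ε)
    (hεA : ENNReal.ofReal ε * (2 ^ (n + 1) * A1Const u) ≤ 1) (x : Rn n) :
    maxOp (fun y => u y ^ (1 + ε)) x ≤ 2 * maxOp u x ^ (1 + ε) := by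
  refine iSup₂_le fun c r => iSup₂_le fun hr hx => ?_
  have hpow : ∫⁻ y in cube c r, ENNReal.ofReal |u y ^ (1 + ε)| =
      ∫⁻ y in cube c r, ENNReal.ofReal |u y| ^ (1 + ε) := by
    refine lintegral_congr_ae (ae_restrict_of_ae ?_)
    filter_upwards [hu.1.2] with y hy
    rw [abs_of_pos (Real.rpow_pos_of_pos hy _), abs_of_pos hy,
      ENNReal.ofReal_rpow_of_pos hy]
  rw [hpow]
  calc (∫⁻ y in cube c r, ENNReal.ofReal |u y| ^ (1 + ε)) / volume (cube c r)
      ≤ 2 * (((∫⁻ x in cube c r, ENNReal.ofReal |u x|) / volume (cube c r)) ^ ε *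
        ∫⁻ x in cube c r, ENNReal.ofReal |u x|) / volume (cube c r) := by
        gcongr
        exact setLIntegral_cube_rpow_le hu hε hεA c hr
    _ = 2 * ((∫⁻ x in cube c r, ENNReal.ofReal |u x|) / volume (cube c r)) ^ (1 + ε) := by
        rw [add_comm, ENNReal.rpow_add_of_nonneg _ _ hε.le zero_le_one, ENNReal.rpow_one,
          mul_div_assoc, mul_div_assoc]
    _ ≤ 2 * maxOp u x ^ (1 + ε) := by
        gcongr
        exact le_maxOp u hr hx

/-- If `u₀ ∈ A₁` and `0 < ε ≤ (2^{n+1}[u₀]_{A₁})⁻¹`, then `u₀^{1+ε} ∈ A₁` with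
`[u₀^{1+ε}]_{A₁} ≲ [u₀]_{A₁}`, with implicit constant depending only on the dimension. -/
theorem stmt7 (n : ℕ) :
    ∃ C : ℝ≥0∞, C < ⊤ ∧ ∀ (u0 : Rn n → ℝ) (ε : ℝ), MemA1 u0 → 0 < ε →
      ENNReal.ofReal ε ≤ 1 / (2 ^ (n + 1) * A1Const u0) →
      A1Const (fun x => u0 x ^ (1 + ε)) ≤ C * A1Const u0 := by
  refine ⟨6, by simp, fun u ε hu hε h => sInf_le ?_⟩
  have hεA := ENNReal.mul_le_of_le_div h
  have h1ε : 0 ≤ 1 + ε := by linarith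
  filter_upwards [ae_maxOp_le_A1Const_mul hu.2, hu.1.2] with x hx hpos
  calc maxOp (fun y => u y ^ (1 + ε)) x ≤ 2 * maxOp u x ^ (1 + ε) := maxOp_rpow_le hu hε hεA x
    _ ≤ 2 * (A1Const u * ENNReal.ofReal (u x)) ^ (1 + ε) := by gcongr
    _ = 2 * A1Const u ^ ε * A1Const u * ENNReal.ofReal (u x ^ (1 + ε)) := by
        rw [ENNReal.mul_rpow_of_nonneg _ _ h1ε, ENNReal.ofReal_rpow_of_pos hpos,
          ENNReal.rpow_add_of_nonneg _ _ zero_le_one hε.le, ENNReal.rpow_one]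
        ring
    _ ≤ 2 * 3 * A1Const u * ENNReal.ofReal (u x ^ (1 + ε)) := by
        gcongr
        exact rpow_le_three hε hu.2.ne hεA
    _ = 6 * A1Const u * ENNReal.ofReal (u x ^ (1 + ε)) := by norm_num
end
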